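/- Let (M,d) be a separable metric space and 1 < λ ≤ 2. If M has property π(λ), then there exists a map f : M → c₀ that is a λ-embedding and is both strict and good; that is, each coordinate fₙ of f has Lipschitz constant strictly less than λ, and d(x,y) < ‖f(x) − f(y)‖ < λ·d(x,y) whenever x ≠ y. -/

import Mathlib

open Metric Set ZeroAtInfty

/-- The gap of a set `E ⊆ M × M`: `inf {d(x,y) : (x,y) ∈ E}`. -/
noncomputable def pairGap {M : Type*} [MetricSpace M] (E : Set (M × M)) : ℝ :=
  sInf ((fun p : M × M => dist p.1 p.2) '' E)

/-- The diameter of a set `E ⊆ M × M`: `sup {d(x,y) : (x,y) ∈ E}`. -/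
noncomputable def pairDiam {M : Type*} [MetricSpace M] (E : Set (M × M)) : ℝ :=
  sSup ((fun p : M × M => dist p.1 p.2) '' E)

/-- `π(E) = π₁(E) × π₂(E)`, the smallest rectangle containing `E`. -/
def pairRect {M : Type*} (E : Set (M × M)) : Set (M × M) :=
  (Prod.fst '' E) ×ˢ (Prod.snd '' E)

/-- `Es` is a finite partition of `E` into nonempty pairwise disjoint pieces. -/
def IsPartition {α : Type*} {N : ℕ} (Es : Fin N → Set α) (E : Set α) : Prop :=
  (∀ n, (Es n).Nonempty) ∧ (⋃ n, Es n) = E ∧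
    ∀ i j : Fin N, i ≠ j → Disjoint (Es i) (Es j)

/-- Property `π(λ)`. -/
def PropertyPi (M : Type*) [MetricSpace M] (lam : ℝ) : Prop :=
  ∀ (a₁ a₂ : M) (r₁ r₂ : ℝ) (E : Set (M × M)),
    E.Nonempty → E ⊆ (closedBall a₁ r₁) ×ˢ (closedBall a₂ r₂) →
    lam * (r₁ + r₂) < pairGap E →
    ∃ (N : ℕ) (Es : Fin N → Set (M × M)), IsPartition Es E ∧
      ∀ n, pairDiam (Es n) < lam * pairGap (pairRect (Es n))

/-- A good-λ-embedding into `c₀`. -/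
def GoodEmbedding {M : Type*} [MetricSpace M] (lam : ℝ) (f : M → C₀(ℕ, ℝ)) : Prop :=
  (∀ n : ℕ, ∃ K : ℝ, K < lam ∧ ∀ x y : M, |f x n - f y n| ≤ K * dist x y) ∧
    ∀ x y : M, dist x y ≤ ‖f x - f y‖

/-- A strict-λ-embedding into `c₀`. -/
def StrictEmbedding {M : Type*} [MetricSpace M] (lam : ℝ) (f : M → C₀(ℕ, ℝ)) : Prop :=
  ∀ x y : M, x ≠ y → dist x y < ‖f x - f y‖ ∧ ‖f x - f y‖ < lam * dist x y

/-- A λ-embedding into `c₀`. -/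
def LambdaEmbedding {M : Type*} [MetricSpace M] (lam : ℝ) (f : M → C₀(ℕ, ℝ)) : Prop :=
  ∀ x y : M, dist x y ≤ ‖f x - f y‖ ∧ ‖f x - f y‖ ≤ lam * dist x y

/-- The gap between two subsets of `M`: `δ(U,V) = inf {d(u,v) : u ∈ U, v ∈ V}`. -/
noncomputable def setGap {M : Type*} [MetricSpace M] (U V : Set M) : ℝ :=
  sInf ((fun p : M × M => dist p.1 p.2) '' (U ×ˢ V))

/-- Every pair of `E` is strictly expanded by one of finitely many functions, each of them
Lipschitz with constant less than `lam` and bounded by `α` on `F`. -/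
def FinitelyExpanded {M : Type*} [MetricSpace M] (lam α : ℝ) (F : Set M) (E : Set (M × M)) :
    Prop :=
  ∃ G : Set (M → ℝ), G.Finite ∧
    (∀ g ∈ G, (∃ K : ℝ, K < lam ∧ ∀ x y : M, |g x - g y| ≤ K * dist x y) ∧
      ∀ z ∈ F, |g z| ≤ α) ∧
    ∀ p ∈ E, ∃ g ∈ G, dist p.1 p.2 < |g p.1 - g p.2|

section

variable {M : Type*} [MetricSpace M]

lemma pairGap_le_dist {E : Set (M × M)} {p : M × M} (hp : p ∈ E) :
    pairGap E ≤ dist p.1 p.2 :=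
  csInf_le ⟨0, by rintro _ ⟨q, -, rfl⟩; exact dist_nonneg⟩ ⟨p, hp, rfl⟩

lemma dist_le_pairDiam {E : Set (M × M)} {C : ℝ} (hC : ∀ p ∈ E, dist p.1 p.2 ≤ C)
    {p : M × M} (hp : p ∈ E) : dist p.1 p.2 ≤ pairDiam E :=
  le_csSup ⟨C, by rintro _ ⟨q, hq, rfl⟩; exact hC q hq⟩ ⟨p, hp, rfl⟩

lemma FinitelyExpanded.biUnion {ι : Type*} {lam α : ℝ} {F : Set M} {T : Set ι} (hT : T.Finite)
    {E : Set (M × M)} {A : ι → Set (M × M)} (hE : E ⊆ ⋃ i ∈ T, A i)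
    (hA : ∀ i ∈ T, FinitelyExpanded lam α F (A i)) : FinitelyExpanded lam α F E := by
  choose! G hfin hG hexp using hA
  refine ⟨⋃ i ∈ T, G i, hT.biUnion hfin, ?_, ?_⟩
  · intro g hg
    obtain ⟨i, hi, hgi⟩ := mem_iUnion₂.1 hg
    exact hG i hi g hgi
  · intro p hp
    obtain ⟨i, hi, hpi⟩ := mem_iUnion₂.1 (hE hp)
    obtain ⟨g, hg, hlt⟩ := hexp i hi p hpi
    exact ⟨g, mem_iUnion₂.2 ⟨i, hi, hg⟩, hlt⟩

/-- Two sets at distance at least `(s + t) / K` are separated by a difference of two cones. -/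
lemma exists_lipschitz_separating {U V : Set M} (hU : U.Nonempty) (hV : V.Nonempty)
    {K s t : ℝ} (hK : 0 ≤ K) (hs : 0 ≤ s) (ht : 0 ≤ t)
    (hgap : ∀ u ∈ U, ∀ v ∈ V, s + t ≤ K * dist u v) :
    ∃ g : M → ℝ, (∀ x y, |g x - g y| ≤ K * dist x y) ∧ (∀ u ∈ U, g u = s) ∧
      (∀ v ∈ V, g v = -t) ∧
      ∀ z, |g z| ≤ max 0 (max (s - K * infDist z U) (t - K * infDist z V)) := by
  have key : ∀ x y, s + t ≤ K * infDist x U + K * infDist y V + K * dist x y := by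
    intro x y
    refine le_of_forall_pos_le_add fun ε hε => ?_
    have hη : 0 < ε / (2 * (K + 1)) := by positivity
    obtain ⟨u, hu, hxu⟩ := (infDist_lt_iff hU).1 (lt_add_of_pos_right (infDist x U) hη)
    obtain ⟨v, hv, hyv⟩ := (infDist_lt_iff hV).1 (lt_add_of_pos_right (infDist y V) hη)
    have h1 : dist u v ≤ dist x u + dist x y + dist y v := by
      have := dist_triangle4 u x y v
      rwa [dist_comm u x] at this
    have h2 : dist u v ≤ infDist x U + infDist y V + dist x y + ε / (K + 1) := by
      have : ε / (K + 1) = ε / (2 * (K + 1)) + ε / (2 * (K + 1)) := by field_simp; ring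
      linarith
    have h3 : K * (ε / (K + 1)) ≤ ε := by
      rw [← mul_div_assoc, div_le_iff₀ (by positivity)]; nlinarith
    have := mul_le_mul_of_nonneg_left h2 hK
    have := hgap u hu v hv
    linarith
  have lip : ∀ W : Set M, ∀ x y, K * infDist y W ≤ K * infDist x W + K * dist x y := by
    intro W x y
    rw [← mul_add, dist_comm x y]
    exact mul_le_mul_of_nonneg_left infDist_le_infDist_add_dist hK
  have hKd : ∀ x y : M, 0 ≤ K * dist x y := fun x y => mul_nonneg hK dist_nonneg
  have hone : ∀ x y, (max 0 (s - K * infDist x U) - max 0 (t - K * infDist x V)) -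
      (max 0 (s - K * infDist y U) - max 0 (t - K * infDist y V)) ≤ K * dist x y := by
    intro x y
    have h1 := key x y
    have h2 := lip U x y
    have h3 := lip V y x
    rw [dist_comm y x] at h3
    have h4 := hKd x y
    rcases max_cases 0 (s - K * infDist x U) with h₅ | h₅ <;>
    rcases max_cases 0 (t - K * infDist x V) with h₆ | h₆ <;>
    rcases max_cases 0 (s - K * infDist y U) with h₇ | h₇ <;>
    rcases max_cases 0 (t - K * infDist y V) with h₈ | h₈ <;> linarith
  refine ⟨fun x => max 0 (s - K * infDist x U) - max 0 (t - K * infDist x V), ?_, ?_, ?_, ?_⟩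
  · intro x y
    refine abs_sub_le_iff.2 ⟨hone x y, ?_⟩
    rw [dist_comm]
    exact hone y x
  · intro u hu
    have h1 := key u u
    simp only [infDist_zero_of_mem hu, dist_self] at h1 ⊢
    rw [max_eq_left (b := t - K * infDist u V) (by linarith), max_eq_right (by linarith)]
    ring
  · intro v hv
    have h1 := key v v
    simp only [infDist_zero_of_mem hv, dist_self] at h1 ⊢
    rw [max_eq_left (b := s - K * infDist v U) (by linarith), max_eq_right (by linarith)]
    ring
  · intro z
    rw [abs_le]
    have h1 : max 0 (s - K * infDist z U) ≤
        max 0 (max (s - K * infDist z U) (t - K * infDist z V)) :=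
      max_le_max le_rfl (le_max_left _ _)
    have h2 : max 0 (t - K * infDist z V) ≤
        max 0 (max (s - K * infDist z U) (t - K * infDist z V)) :=
      max_le_max le_rfl (le_max_right _ _)
    have h3 := le_max_left 0 (s - K * infDist z U)
    have h4 := le_max_left 0 (t - K * infDist z V)
    constructor <;> linarith

/-- A single function expands all pairs of `E` when the diameter of `E` is small compared with
the gap of its enclosing rectangle and with the distances of its projections to `F`. -/
lemma finitelyExpanded_of_diam_lt {lam α s t C : ℝ} {F : Set M}
    {E : Set (M × M)} (hlam : 0 < lam) (hα : 0 ≤ α) (hC : ∀ p ∈ E, dist p.1 p.2 ≤ C)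
    (hdiam : pairDiam E < lam * pairGap (pairRect E))
    (hst : pairDiam E < lam * (s + t) + 2 * α)
    (hs : 0 < lam * s + α) (ht : 0 < lam * t + α)
    (hsF : ∀ p ∈ E, s ≤ infDist p.1 F) (htF : ∀ p ∈ E, t ≤ infDist p.2 F) :
    FinitelyExpanded lam α F E := by
  rcases E.eq_empty_or_nonempty with rfl | hne
  · exact ⟨∅, finite_empty, by simp, by simp⟩
  have tends : ∀ a b : ℝ, Filter.Tendsto (fun K : ℝ => K * a + b) (nhdsWithin lam (Iio lam))
      (nhds (lam * a + b)) := fun a b =>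
    ((continuous_id.mul continuous_const).add continuous_const).continuousAt.mono_left
      nhdsWithin_le_nhds
  obtain ⟨K, hK1, hK2, hK3, hK4, hK0, hKlam⟩ :=
    (((tends (pairGap (pairRect E)) 0).eventually_const_lt (by simpa using hdiam)).and
      (((tends (s + t) (2 * α)).eventually_const_lt hst).and
      (((tends s α).eventually_const_lt hs).and
      (((tends t α).eventually_const_lt ht).and
      (((tends 1 0).eventually_const_lt (by simpa using hlam)).and
        (self_mem_nhdsWithin : Iio lam ∈ nhdsWithin lam (Iio lam))))))).exists
  simp only [mul_one, add_zero] at hK0 hK1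
  obtain ⟨D, hD, hD'⟩ := exists_between (lt_min hK1 hK2)
  obtain ⟨hD1, hD2⟩ := lt_min_iff.1 hD'
  obtain ⟨p₀, hp₀⟩ := hne
  have hD0 : 0 < D := (dist_nonneg.trans (dist_le_pairDiam hC hp₀)).trans_lt hD
  have hs' : 0 ≤ min D (K * s + α) := le_min hD0.le hK3.le
  have ht' : 0 ≤ D - min D (K * s + α) := sub_nonneg.2 (min_le_left _ _)
  obtain ⟨g, hlip, hgU, hgV, hg⟩ := exists_lipschitz_separating (U := Prod.fst '' E)
    (V := Prod.snd '' E) ⟨_, p₀, hp₀, rfl⟩ ⟨_, p₀, hp₀, rfl⟩ hK0.le hs' ht' (by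
      intro u hu v hv
      rw [add_sub_cancel]
      have : pairGap (pairRect E) ≤ dist u v :=
        pairGap_le_dist (E := pairRect E) (p := (u, v)) ⟨hu, hv⟩
      exact hD1.le.trans (mul_le_mul_of_nonneg_left this hK0.le))
  refine ⟨{g}, finite_singleton g, ?_, ?_⟩
  · rintro _ rfl
    refine ⟨⟨K, hKlam, hlip⟩, fun z hz => (hg z).trans (max_le hα (max_le ?_ ?_))⟩
    · have : s ≤ infDist z (Prod.fst '' E) := by
        refine (le_infDist (Nonempty.image _ ⟨p₀, hp₀⟩)).2 ?_
        rintro _ ⟨q, hq, rfl⟩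
        rw [dist_comm]
        exact (hsF q hq).trans (infDist_le_dist_of_mem hz)
      have := mul_le_mul_of_nonneg_left this hK0.le
      have := min_le_right D (K * s + α)
      linarith
    · have : t ≤ infDist z (Prod.snd '' E) := by
        refine (le_infDist (Nonempty.image _ ⟨p₀, hp₀⟩)).2 ?_
        rintro _ ⟨q, hq, rfl⟩
        rw [dist_comm]
        exact (htF q hq).trans (infDist_le_dist_of_mem hz)
      have := mul_le_mul_of_nonneg_left this hK0.le
      rcases min_cases D (K * s + α) with h | h <;> linarith
  · intro p hp
    refine ⟨g, rfl, ?_⟩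
    rw [hgU _ ⟨p, hp, rfl⟩, hgV _ ⟨p, hp, rfl⟩, sub_neg_eq_add, add_sub_cancel, abs_of_pos hD0]
    exact (dist_le_pairDiam hC hp).trans_lt hD

lemma PropertyPi.finitelyExpanded_of_centers {lam α β : ℝ} (h : PropertyPi M lam)
    (hlam : 1 < lam) (hα : 0 < α) (hβ : 0 < β) {F : Set M} (hF : F.Nonempty) (a b : M) :
    FinitelyExpanded lam α F {p : M × M |
      lam * (dist p.1 a + dist p.2 b) + β ≤ dist p.1 p.2 ∧
      dist p.1 p.2 < lam * (infDist p.1 F + infDist p.2 F) + α} := by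
  set E : Set (M × M) := {p : M × M |
      lam * (dist p.1 a + dist p.2 b) + β ≤ dist p.1 p.2 ∧
      dist p.1 p.2 < lam * (infDist p.1 F + infDist p.2 F) + α} with hE
  obtain ⟨z, hz⟩ := hF
  obtain ⟨ε, hε, hεα, hεβ⟩ : ∃ ε : ℝ, 0 < ε ∧ 4 * lam * ε < α ∧ 4 * lam * ε < β := by
    refine ⟨min α β / (8 * lam), by positivity, ?_, ?_⟩
    · have : 4 * lam * (min α β / (8 * lam)) = min α β / 2 := by field_simp; ring
      have := min_le_left α β
      linarith
    · have : 4 * lam * (min α β / (8 * lam)) = min α β / 2 := by field_simp; ring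
      have := min_le_right α β
      linarith
  let φ : M × M → ℝ × ℝ × ℝ × ℝ := fun p =>
    (dist p.1 a, dist p.2 b, infDist p.1 F, infDist p.2 F)
  set R : ℝ := dist a b / (lam - 1) with hR
  have hbound : ∀ p ∈ E, dist p.1 a + dist p.2 b ≤ R := by
    rintro p ⟨hp, -⟩
    rw [hR, le_div_iff₀ (by linarith)]
    have := dist_triangle4 p.1 a b p.2
    rw [dist_comm b] at this
    linarith
  have hbdd : Bornology.IsBounded (φ '' E) := by
    refine (Metric.isBounded_Icc (0 : ℝ × ℝ × ℝ × ℝ)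
      (R, R, R + dist a z, R + dist b z)).subset ?_
    rintro _ ⟨p, hp, rfl⟩
    have h1 := hbound p hp
    have h2 : 0 ≤ dist p.1 a := dist_nonneg
    have h3 : 0 ≤ dist p.2 b := dist_nonneg
    have h4 := (infDist_le_dist_of_mem (x := p.1) hz).trans (dist_triangle p.1 a z)
    have h5 := (infDist_le_dist_of_mem (x := p.2) hz).trans (dist_triangle p.2 b z)
    exact ⟨⟨h2, h3, infDist_nonneg, infDist_nonneg⟩,
      ⟨by simp only [φ]; linarith, by simp only [φ]; linarith,
        by simp only [φ]; linarith, by simp only [φ]; linarith⟩⟩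
  obtain ⟨T, hT, hcov⟩ := Metric.totallyBounded_iff.1
    (hbdd.isCompact_closure.totallyBounded.subset subset_closure) ε hε
  refine FinitelyExpanded.biUnion (A := fun c => E ∩ φ ⁻¹' ball c ε) hT ?_ ?_
  · intro p hp
    obtain ⟨c, hc, hpc⟩ := mem_iUnion₂.1 (hcov ⟨p, hp, rfl⟩)
    exact mem_iUnion₂.2 ⟨c, hc, hp, hpc⟩
  rintro ⟨c₁, c₂, c₃, c₄⟩ -
  set A := E ∩ φ ⁻¹' ball (c₁, c₂, c₃, c₄) ε with hA
  have hclose : ∀ p ∈ A, |dist p.1 a - c₁| < ε ∧ |dist p.2 b - c₂| < ε ∧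
      |infDist p.1 F - c₃| < ε ∧ |infDist p.2 F - c₄| < ε := by
    rintro p ⟨-, hp⟩
    simpa [φ, Prod.dist_eq, Real.dist_eq] using hp
  simp only [abs_sub_lt_iff] at hclose
  rcases A.eq_empty_or_nonempty with hAe | hne
  · exact ⟨∅, finite_empty, by simp, by simp [hAe]⟩
  have hgap : lam * ((c₁ + ε) + (c₂ + ε)) < pairGap A := by
    have : lam * ((c₁ - ε) + (c₂ - ε)) + β ≤ pairGap A := by
      refine le_csInf (hne.image _) ?_
      rintro _ ⟨p, hp, rfl⟩
      obtain ⟨h1, h2, -, -⟩ := hclose p hp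
      refine le_trans ?_ hp.1.1
      have : (c₁ - ε) + (c₂ - ε) ≤ dist p.1 a + dist p.2 b := by linarith
      have := mul_le_mul_of_nonneg_left this (by linarith : 0 ≤ lam)
      linarith
    linarith
  obtain ⟨N, Es, ⟨hEne, hEU, -⟩, hEs⟩ := h a b (c₁ + ε) (c₂ + ε) A hne (by
    intro p hp
    obtain ⟨h1, h2, -, -⟩ := hclose p hp
    exact ⟨mem_closedBall.2 (by linarith), mem_closedBall.2 (by linarith)⟩) hgap
  refine FinitelyExpanded.biUnion (T := univ) (A := Es) finite_univ (by simp [hEU]) fun n _ => ?_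
  have hsub : Es n ⊆ A := hEU ▸ subset_iUnion Es n
  have hlt : ∀ p ∈ Es n, dist p.1 p.2 ≤ lam * (c₃ + c₄ + 2 * ε) + α := by
    intro p hp
    obtain ⟨-, -, h3, h4⟩ := hclose p (hsub hp)
    refine (hsub hp).1.2.le.trans ?_
    have : infDist p.1 F + infDist p.2 F ≤ c₃ + c₄ + 2 * ε := by linarith
    have := mul_le_mul_of_nonneg_left this (by linarith : 0 ≤ lam)
    linarith
  have hpos : -(2 * ε) ≤ c₃ - ε ∧ -(2 * ε) ≤ c₄ - ε := by
    obtain ⟨p, hp⟩ := hne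
    obtain ⟨-, -, h3, h4⟩ := hclose p hp
    have h5 : 0 ≤ infDist p.1 F := infDist_nonneg
    have h6 : 0 ≤ infDist p.2 F := infDist_nonneg
    constructor <;> linarith
  refine finitelyExpanded_of_diam_lt (s := c₃ - ε) (t := c₄ - ε) (by linarith) hα.le hlt
    (hEs n) ?_ ?_ ?_ ?_ ?_
  · have : pairDiam (Es n) ≤ lam * (c₃ + c₄ + 2 * ε) + α := by
      refine csSup_le ((hEne n).image _) ?_
      rintro _ ⟨p, hp, rfl⟩
      exact hlt p hp
    linarith
  · nlinarith [hpos.1]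
  · nlinarith [hpos.2]
  · intro p hp
    linarith [(hclose p (hsub hp)).2.2.1.2]
  · intro p hp
    linarith [(hclose p (hsub hp)).2.2.2.2]

lemma PropertyPi.finitelyExpanded {lam α β : ℝ} (h : PropertyPi M lam)
    (hlam : 1 < lam) (hα : 0 < α) (hβ : 0 < β) {F F' : Set M} (hF : F.Nonempty)
    (hF' : F'.Nonempty) (hfin : F'.Finite) :
    FinitelyExpanded lam α F {p : M × M |
      lam * (infDist p.1 F' + infDist p.2 F') + β ≤ dist p.1 p.2 ∧
      dist p.1 p.2 < lam * (infDist p.1 F + infDist p.2 F) + α} := by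
  refine FinitelyExpanded.biUnion (hfin.prod hfin) ?_ fun c _ =>
    h.finitelyExpanded_of_centers hlam hα hβ hF c.1 c.2
  rintro p ⟨hp, hp'⟩
  obtain ⟨a, ha, hpa⟩ := hfin.isCompact.exists_infDist_eq_dist hF' p.1
  obtain ⟨b, hb, hpb⟩ := hfin.isCompact.exists_infDist_eq_dist hF' p.2
  rw [hpa, hpb] at hp
  exact mem_iUnion₂.2 ⟨(a, b), ⟨ha, hb⟩, hp, hp'⟩

/-- The norm of an element of `c₀` is attained. -/
lemma exists_norm_eq_abs_apply (f : C₀(ℕ, ℝ)) : ∃ n, ‖f‖ = |f n| := by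
  have hle : ∀ n, |f n| ≤ ‖f‖ := fun n => f.toBCF.norm_coe_le_norm n
  rcases eq_or_ne ‖f‖ 0 with h0 | h0
  · exact ⟨0, le_antisymm (h0 ▸ abs_nonneg _) (hle 0)⟩
  have hpos : 0 < ‖f‖ := lt_of_le_of_ne (norm_nonneg f) h0.symm
  by_contra! hne
  have hlt : ∀ n, |f n| < ‖f‖ := fun n => lt_of_le_of_ne (hle n) (hne n).symm
  have hfin : {n | ‖f‖ / 2 ≤ |f n|}.Finite := by
    have h1 := f.zero_at_infty'
    rw [Filter.cocompact_eq_cofinite] at h1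
    have h2 := h1.abs.eventually_lt_const (u := ‖f‖ / 2) (by simpa using hpos)
    simpa [Filter.eventually_cofinite] using h2
  obtain ⟨C, hC, hCb⟩ : ∃ C < ‖f‖, ∀ n, |f n| ≤ C := by
    rcases Set.eq_empty_or_nonempty {n | ‖f‖ / 2 ≤ |f n|} with he | hn
    · refine ⟨‖f‖ / 2, by linarith, fun n => ?_⟩
      by_contra! hcon
      exact Set.eq_empty_iff_forall_notMem.1 he n hcon.le
    · obtain ⟨m, hm, hmax⟩ := Set.exists_max_image _ (fun n => |f n|) hfin hn
      refine ⟨|f m|, hlt m, fun n => ?_⟩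
      by_cases hn' : ‖f‖ / 2 ≤ |f n|
      · exact hmax n hn'
      · have : ‖f‖ / 2 ≤ |f m| := hm
        linarith
  have : ‖f‖ ≤ C := by
    change ‖f.toBCF‖ ≤ C
    exact (BoundedContinuousFunction.norm_le ((abs_nonneg _).trans (hCb 0))).2 hCb
  linarith

/-- A countable family of real functions, tending to zero at every point and each Lipschitz with
constant less than `lam`, which strictly expands every pair of points gives a good and strict
embedding into `c₀`. -/
lemma exists_good_strict_embedding {ι : Type*} [Countable ι] {lam : ℝ} (hlam : 0 < lam)
    (g : ι → M → ℝ)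
    (hlip : ∀ i, ∃ K : ℝ, K < lam ∧ ∀ x y : M, |g i x - g i y| ≤ K * dist x y)
    (hzero : ∀ x, ∀ ε > 0, {i | ε ≤ |g i x|}.Finite)
    (hexp : ∀ x y, x ≠ y → ∃ i, dist x y < |g i x - g i y|) :
    ∃ f : M → C₀(ℕ, ℝ), GoodEmbedding lam f ∧ StrictEmbedding lam f := by
  obtain ⟨e, he⟩ := exists_injective_nat ι
  have hval : ∀ x i, Function.extend e (fun i => g i x) 0 (e i) = g i x := fun x i =>
    he.extend_apply _ _ i
  have hout : ∀ x n, (¬ ∃ i, e i = n) → Function.extend e (fun i => g i x) 0 n = 0 :=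
    fun x n hn => Function.extend_apply' _ _ _ hn
  let f : M → C₀(ℕ, ℝ) := fun x =>
    ⟨⟨Function.extend e (fun i => g i x) 0, continuous_of_discreteTopology⟩, by
      rw [Filter.cocompact_eq_cofinite, Metric.tendsto_nhds]
      intro ε hε
      rw [Filter.eventually_cofinite]
      refine ((hzero x ε hε).image e).subset fun n hn => ?_
      by_cases hi : ∃ i, e i = n
      · obtain ⟨i, rfl⟩ := hi
        refine ⟨i, ?_, rfl⟩
        simpa [hval, Real.dist_eq] using hn
      · exact absurd hε (by simpa [hout x n hi] using hn)⟩
  have hf : ∀ x n, f x n = Function.extend e (fun i => g i x) 0 n := fun x n => rfl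
  have hgood : ∀ n : ℕ, ∃ K : ℝ, K < lam ∧ ∀ x y : M, |f x n - f y n| ≤ K * dist x y := by
    intro n
    by_cases hi : ∃ i, e i = n
    · obtain ⟨i, rfl⟩ := hi
      simpa only [hf, hval] using hlip i
    · exact ⟨0, hlam, fun x y => by simp [hf, hout _ n hi]⟩
  have hstrict : StrictEmbedding lam f := by
    intro x y hxy
    constructor
    · obtain ⟨i, hi⟩ := hexp x y hxy
      refine hi.trans_le ?_
      have := (f x - f y).toBCF.norm_coe_le_norm (e i)
      change |f x (e i) - f y (e i)| ≤ ‖f x - f y‖ at this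
      simpa only [hf, hval] using this
    · obtain ⟨n, hn⟩ := exists_norm_eq_abs_apply (f x - f y)
      obtain ⟨K, hK, hKlip⟩ := hgood n
      rw [hn]
      exact (hKlip x y).trans_lt (mul_lt_mul_of_pos_right hK (dist_pos.2 hxy))
  refine ⟨f, ⟨hgood, fun x y => ?_⟩, hstrict⟩
  rcases eq_or_ne x y with rfl | hxy
  · simp
  · exact (hstrict x y hxy).1.le

end

/-- Theorem 4.1: if a separable metric space `M` has property π(λ) with `1 < λ ≤ 2`, then there
is a λ-embedding of `M` into `c₀` which is both strict and good. -/
theorem stmt8 {M : Type*} [MetricSpace M] [TopologicalSpace.SeparableSpace M]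
    (lam : ℝ) (hlam₁ : 1 < lam) (hlam₂ : lam ≤ 2) (h : PropertyPi M lam) :
    ∃ f : M → C₀(ℕ, ℝ), GoodEmbedding lam f ∧ StrictEmbedding lam f := by
  rcases isEmpty_or_nonempty M with hM | hM
  · exact ⟨fun _ => 0, ⟨fun _ => ⟨0, by linarith, fun x => hM.elim x⟩, fun x => hM.elim x⟩,
      fun x => hM.elim x⟩
  let u := TopologicalSpace.denseSeq M
  let F : ℕ → Set M := fun k => u '' Iic k
  let α : ℕ → ℝ := fun k => 1 / ((k : ℝ) + 1)
  have hα : ∀ k, 0 < α k := fun k => Nat.one_div_pos_of_nat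
  have hF : ∀ k, (F k).Nonempty := fun k => ⟨u k, k, self_mem_Iic, rfl⟩
  have hsmall : ∀ x : M, ∀ ε > 0, ∃ k, ∀ m ≥ k, infDist x (F m) < ε ∧ α m < ε := by
    intro x ε hε
    obtain ⟨n, hn⟩ := (TopologicalSpace.denseRange_denseSeq M).exists_dist_lt x hε
    obtain ⟨j, hj⟩ := exists_nat_one_div_lt hε
    refine ⟨max n j, fun m hm => ⟨?_, ?_⟩⟩
    · exact (infDist_le_dist_of_mem
        (mem_image_of_mem u (mem_Iic.2 ((le_max_left n j).trans hm)))).trans_lt hn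
    · exact (Nat.one_div_le_one_div ((le_max_right n j).trans hm)).trans_lt hj
  choose G hfin hG hexp using fun k : ℕ => h.finitelyExpanded hlam₁ (hα k) (hα (k + 1)) (hF k)
    (hF (k + 1)) ((finite_Iic (k + 1)).image u)
  have : ∀ k, Finite (G k) := fun k => (hfin k).to_subtype
  refine exists_good_strict_embedding (ι := Σ k, G k) (by linarith) (fun i => i.2.1)
    (fun i => (hG i.1 i.2.1 i.2.2).1) ?_ ?_
  · intro x ε hε
    obtain ⟨k, hk⟩ := hsmall x (ε / (lam + 1)) (by positivity)
    have hfinite : (⋃ m ∈ Iio k, range (fun g : G m => (⟨m, g⟩ : Σ k, G k))).Finite :=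
      (finite_Iio k).biUnion fun m _ => finite_range _
    refine hfinite.subset ?_
    rintro ⟨m, g, hg⟩ hi
    refine mem_iUnion₂.2 ⟨m, ?_, ⟨g, hg⟩, rfl⟩
    by_contra hm
    obtain ⟨h1, h2⟩ := hk m (not_lt.1 hm)
    obtain ⟨⟨K, hK, hlip⟩, hgF⟩ := hG m g hg
    obtain ⟨z, hz, hxz⟩ := (infDist_lt_iff (hF m)).1 h1
    have h3 : |g x| ≤ |g x - g z| + |g z| := by
      simpa using abs_add_le (g x - g z) (g z)
    have h4 : K * dist x z ≤ lam * (ε / (lam + 1)) :=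
      (mul_le_mul_of_nonneg_right hK.le dist_nonneg).trans
        (mul_le_mul_of_nonneg_left hxz.le (by linarith))
    have h5 : lam * (ε / (lam + 1)) + ε / (lam + 1) = ε := by field_simp
    have h6 : ε ≤ |g x| := hi
    linarith [hlip x z, hgF z hz]
  · intro x y hxy
    have hd : 0 < dist x y := dist_pos.2 hxy
    have hex : ∃ k, lam * (infDist x (F k) + infDist y (F k)) + α k ≤ dist x y := by
      obtain ⟨k, hk⟩ := hsmall x (dist x y / (2 * lam + 1)) (by positivity)
      obtain ⟨j, hj⟩ := hsmall y (dist x y / (2 * lam + 1)) (by positivity)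
      refine ⟨max k j, ?_⟩
      obtain ⟨h1, h2⟩ := hk (max k j) (le_max_left _ _)
      obtain ⟨h3, -⟩ := hj (max k j) (le_max_right _ _)
      have h4 : lam * (dist x y / (2 * lam + 1) + dist x y / (2 * lam + 1)) +
          dist x y / (2 * lam + 1) = dist x y := by field_simp; ring
      have h5 := mul_le_mul_of_nonneg_left (add_le_add h1.le h3.le) (by linarith : 0 ≤ lam)
      linarith
    classical
    obtain ⟨k, hk⟩ : ∃ k, Nat.find hex = k + 1 := by
      refine Nat.exists_eq_succ_of_ne_zero fun h0 => ?_
      have hspec := Nat.find_spec hex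
      rw [h0] at hspec
      have hF0 : F 0 = {u 0} := by simp [F, Iic]
      rw [hF0, infDist_singleton, infDist_singleton] at hspec
      have h1 := dist_triangle_right x y (u 0)
      have h2 := hα 0
      nlinarith
    have hspec := Nat.find_spec hex
    have hmin := Nat.find_min hex (m := k) (by omega)
    rw [hk] at hspec
    obtain ⟨g, hg, hlt⟩ := hexp k (x, y) ⟨hspec, not_le.1 hmin⟩
    exact ⟨⟨k, g, hg⟩, hlt⟩
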